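/- arXiv:1610.04626 — 2 statements merged into one kernel-verified Lean document; each statement's English description precedes it below -/
import Mathlib

section
/- The only inflexion point of the cubic curve q(a,b,c) = 0 defined over ℚ is (1 : −1 : 0). Precisely: if rational numbers a, b, c, not all zero, satisfy q(a,b,c) = 0 and the determinant of the 3×3 Hessian matrix of second partial derivatives of q vanishes at (a,b,c), then (a,b,c) is a scalar multiple of (1, −1, 0). -/
open MvPolynomial

/-- The Sharygin cubic as a polynomial in three variables `a = X 0`, `b = X 1`, `c = X 2`. -/
noncomputable def qPoly : MvPolynomial (Fin 3) ℚ :=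
  -(X 2) ^ 3 - (X 2) ^ 2 * (X 0 + X 1) + X 2 * ((X 0) ^ 2 + X 0 * X 1 + (X 1) ^ 2) +
    ((X 0) ^ 3 + (X 0) ^ 2 * X 1 + X 0 * (X 1) ^ 2 + (X 1) ^ 3)

/-- The Hessian determinant of the Sharygin cubic. -/
noncomputable def qHessianDet : MvPolynomial (Fin 3) ℚ :=
  Matrix.det (Matrix.of fun i j : Fin 3 => pderiv i (pderiv j qPoly))

/-- Modulo `5` the binary quartic form attached to the `3`-division polynomial is anisotropic. -/
theorem quartic_anisotropic_zmod_five : ∀ x y : ZMod 5,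
    27 * x ^ 4 - 87 * x ^ 3 * y + 90 * x ^ 2 * y ^ 2 - 36 * x * y ^ 3 + 4 * y ^ 4 = 0 →
      x = 0 ∧ y = 0 := by
  decide

theorem quartic_anisotropic_rat {x y : ℚ}
    (h : 27 * x ^ 4 - 87 * x ^ 3 * y + 90 * x ^ 2 * y ^ 2 - 36 * x * y ^ 3 + 4 * y ^ 4 = 0) :
    x = 0 ∧ y = 0 := by
  by_cases hy : y = 0
  · subst hy
    simpa using h
  exfalso
  set r : ℚ := x / y with hr
  have hx : x = r * y := by rw [hr]; field_simp
  have h1 : 27 * r ^ 4 - 87 * r ^ 3 + 90 * r ^ 2 - 36 * r + 4 = 0 := by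
    have : y ^ 4 * (27 * r ^ 4 - 87 * r ^ 3 + 90 * r ^ 2 - 36 * r + 4) = 0 := by
      rw [hx] at h
      linear_combination h
    exact (mul_eq_zero.mp this).resolve_left (pow_ne_zero 4 hy)
  have hd : (r.den : ℚ) ≠ 0 := by exact_mod_cast r.den_nz
  have hn : (r.num : ℚ) = r * r.den := (Rat.mul_den_eq_num r).symm
  have h2 : 27 * r.num ^ 4 - 87 * r.num ^ 3 * (r.den : ℤ) + 90 * r.num ^ 2 * (r.den : ℤ) ^ 2
      - 36 * r.num * (r.den : ℤ) ^ 3 + 4 * (r.den : ℤ) ^ 4 = 0 := by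
    have : (27 * r.num ^ 4 - 87 * r.num ^ 3 * r.den + 90 * r.num ^ 2 * r.den ^ 2
        - 36 * r.num * r.den ^ 3 + 4 * r.den ^ 4 : ℚ) = 0 := by
      rw [hn]
      linear_combination (r.den : ℚ) ^ 4 * h1
    exact_mod_cast this
  have h3 := congrArg (Int.cast : ℤ → ZMod 5) h2
  push_cast at h3
  obtain ⟨hn5, hd5⟩ := quartic_anisotropic_zmod_five _ _ h3
  have hn5' : 5 ∣ r.num.natAbs :=
    Int.natCast_dvd.mp ((ZMod.intCast_zmod_eq_zero_iff_dvd r.num 5).mp hn5)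
  have hd5' : 5 ∣ r.den := (ZMod.natCast_eq_zero_iff r.den 5).mp hd5
  have := Nat.dvd_gcd hn5' hd5'
  rw [r.reduced.gcd_eq_one] at this
  omega

theorem eval_qPoly (a b c : ℚ) : eval ![a, b, c] qPoly =
    -c ^ 3 - c ^ 2 * (a + b) + c * (a ^ 2 + a * b + b ^ 2) +
      (a ^ 3 + a ^ 2 * b + a * b ^ 2 + b ^ 3) := by
  simp [qPoly]

theorem eval_qHessianDet (a b c : ℚ) : eval ![a, b, c] qHessianDet =
    Matrix.det !![6 * a + 2 * b + 2 * c, 2 * a + 2 * b + c, 2 * a + b - 2 * c;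
      2 * a + 2 * b + c, 2 * a + 6 * b + 2 * c, a + 2 * b - 2 * c;
      2 * a + b - 2 * c, a + 2 * b - 2 * c, -2 * a - 2 * b - 6 * c] := by
  simp only [qHessianDet, RingHom.map_det]
  congr 1
  ext i j
  fin_cases i <;> fin_cases j <;>
    simp [qPoly, pderiv_X, Pi.single_apply, pow_succ] <;> ring

/-- The only rational inflexion point of the cubic `q = 0` is `(1 : −1 : 0)`: any nonzero
rational solution of `q = 0` at which the Hessian determinant vanishes is a scalar multiple
of `(1, −1, 0)`. -/
theorem sharygin_cubic_rational_inflexion (a b c : ℚ)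
    (hne : ¬(a = 0 ∧ b = 0 ∧ c = 0))
    (hq : eval ![a, b, c] qPoly = 0)
    (hH : eval ![a, b, c] qHessianDet = 0) :
    ∃ t : ℚ, a = t * 1 ∧ b = t * (-1) ∧ c = t * 0 := by
  rw [eval_qPoly] at hq
  rw [eval_qHessianDet, Matrix.det_fin_three] at hH
  simp at hH
  have key := quartic_anisotropic_rat (x := a + b) (y := 2 * (a + b) + c) (by
    linear_combination (2 * (a + b) + c) / 8 * hH -
      (-72 * (a + b) + 58 * (2 * (a + b) + c)) / 8 * hq)
  exact ⟨a, by ring, by linarith [key.1], by linarith [key.1, key.2]⟩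
end

section
/- There exist infinitely many pairwise non-similar integer Sharygin triangles: the set of triples (a, b, c) of positive integers with gcd(a, b, c) = 1, with a, b, c pairwise distinct, satisfying the triangle inequalities a < b + c, b < a + c, c < a + b, and satisfying q(a,b,c) = 0, is infinite. -/
/-- The Sharygin cubic form `q(a,b,c)` over the integers. -/
def q (a b c : ℤ) : ℤ :=
  -c ^ 3 - c ^ 2 * (a + b) + c * (a ^ 2 + a * b + b ^ 2) +
    (a ^ 3 + a ^ 2 * b + a * b ^ 2 + b ^ 3)

/-- `x` is the abscissa and `y` the positive ordinate of a rational point on the component of the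
identity of the elliptic curve `y² = x³ + 5x² - 32x`. -/
def IsPositivePoint (x y : ℚ) : Prop :=
  0 < x ∧ 0 < y ∧ y ^ 2 = x ^ 3 + 5 * x ^ 2 - 32 * x

lemma IsPositivePoint.three_lt {x y : ℚ} (h : IsPositivePoint x y) : 3 < x := by
  obtain ⟨hx, hy, h⟩ := h
  by_contra! hx3
  have : 0 < x * (x ^ 2 + 5 * x - 32) := by nlinarith [pow_pos hy 2]
  have := (mul_pos_iff_of_pos_left hx).1 this
  nlinarith

lemma IsPositivePoint.four_le {x y : ℚ} (h : IsPositivePoint x y) (hx : 4 ≤ x) : 4 ≤ y := by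
  obtain ⟨-, hy, h⟩ := h
  have : 4 ≤ x ^ 2 + 5 * x - 32 := by nlinarith
  nlinarith [mul_le_mul hx this (by norm_num) (by linarith)]

lemma isPositivePoint_abs {x y : ℚ} (hx : 15 / 4 ≤ x)
    (h : y ^ 2 = x ^ 3 + 5 * x ^ 2 - 32 * x) : IsPositivePoint x |y| := by
  refine ⟨by linarith, abs_pos.2 ?_, by rw [sq_abs, h]⟩
  rintro rfl
  have h1 : 0 < x ^ 2 + 5 * x - 32 := by nlinarith
  have h2 : 0 < x := by linarith
  nlinarith [mul_pos h2 h1]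

/-- The third intersection point of a chord with the elliptic curve lies on the curve. -/
lemma chord_identity {x₁ y₁ x₂ y₂ l : ℚ} (hne : x₁ ≠ x₂)
    (h₁ : y₁ ^ 2 = x₁ ^ 3 + 5 * x₁ ^ 2 - 32 * x₁)
    (h₂ : y₂ ^ 2 = x₂ ^ 3 + 5 * x₂ ^ 2 - 32 * x₂) (hl : l * (x₂ - x₁) = y₂ - y₁) :
    (y₁ + l * (l ^ 2 - 5 - x₁ - x₂ - x₁)) ^ 2 =
      (l ^ 2 - 5 - x₁ - x₂) ^ 3 + 5 * (l ^ 2 - 5 - x₁ - x₂) ^ 2 -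
        32 * (l ^ 2 - 5 - x₁ - x₂) := by
  obtain rfl : y₂ = y₁ + l * (x₂ - x₁) := by linarith
  have hs : 2 * l * y₁ + l ^ 2 * (x₂ - x₁) =
      x₂ ^ 2 + x₁ * x₂ + x₁ ^ 2 + 5 * (x₁ + x₂) - 32 := by
    apply mul_right_cancel₀ (sub_ne_zero.2 hne.symm)
    linear_combination h₂ - h₁
  linear_combination h₁ + (l ^ 2 - 5 - x₁ - x₂ - x₁) * hs

/-- Points of the curve in the kernel of reduction modulo `2`, obtained by repeated doubling. -/
lemma exists_point_two_pow (k : ℕ) : ∃ m n u : ℤ, 0 < m ∧ Odd m ∧ Odd n ∧ Odd u ∧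
    n ^ 2 = m ^ 3 + 5 * m ^ 2 * (2 ^ (k + 2) * u) ^ 2 - 32 * m * (2 ^ (k + 2) * u) ^ 4 := by
  induction k with
  | zero => exact ⟨121, 1397, 1, by norm_num, by decide, by decide, by decide, by norm_num⟩
  | succ k ih =>
    obtain ⟨m, n, u, hm, hmo, hno, huo, h⟩ := ih
    obtain ⟨e, he⟩ : ∃ e : ℤ, e = 2 ^ (k + 2) * u := ⟨_, rfl⟩
    have hee : Even e := ⟨2 ^ (k + 1) * u, by rw [he]; ring⟩
    rw [← he] at h
    refine ⟨(m ^ 2 + 32 * e ^ 4) ^ 2,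
      (3 * m ^ 2 + 10 * m * e ^ 2 - 32 * e ^ 4) * ((m ^ 2 + 32 * e ^ 4) ^ 2 - 4 * n ^ 2 * m) +
        8 * n ^ 4, n * u, by positivity, ?_, ?_, hno.mul huo, ?_⟩
    · have he4 : Even (32 * e ^ 4) := (by decide : Even (32 : ℤ)).mul_right _
      exact (hmo.pow.add_even he4).pow
    · have h8 : Even (8 * n ^ 4) := (by decide : Even (8 : ℤ)).mul_right _
      have h32 : Even (32 * e ^ 4) := (by decide : Even (32 : ℤ)).mul_right _
      have h10 : Even (10 * m * e ^ 2) := ((by decide : Even (10 : ℤ)).mul_right _).mul_right _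
      have h4 : Even (4 * n ^ 2 * m) := ((by decide : Even (4 : ℤ)).mul_right _).mul_right _
      have h3 : Odd (3 * m ^ 2) := (by decide : Odd (3 : ℤ)).mul hmo.pow
      exact (((h3.add_even h10).sub_even h32).mul
        ((hmo.pow.add_even h32).pow.sub_even h4)).add_even h8
    · have h2 : (2 ^ (k + 1 + 2) * (n * u)) ^ 2 = 4 * n ^ 2 * e ^ 2 := by rw [he]; ring
      have h4 : (2 ^ (k + 1 + 2) * (n * u)) ^ 4 = (4 * n ^ 2 * e ^ 2) ^ 2 := by rw [← h2]; ring
      rw [h2, h4, show n ^ 4 = (n ^ 2) ^ 2 by ring, h]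
      ring

lemma infinite_positivePoints : {x : ℚ | ∃ y, IsPositivePoint x y}.Infinite := by
  refine Set.Infinite.of_image (padicValRat 2)
    ((Set.infinite_range_of_injective (f := fun k : ℕ => -(2 * (k + 2) : ℤ)) ?_).mono ?_)
  · intro i j hij
    simpa using hij
  rintro _ ⟨k, rfl⟩
  obtain ⟨m, n, u, hm, hmo, hno, huo, h⟩ := exists_point_two_pow k
  have hn0 : (n : ℚ) ≠ 0 := by rintro h0; simp_all
  have hu0 : (u : ℚ) ≠ 0 := by rintro h0; simp_all
  have hm0 : (0 : ℚ) < m := by exact_mod_cast hm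
  have hq : (n : ℚ) ^ 2 = m ^ 3 + 5 * m ^ 2 * (2 ^ (k + 2) * u) ^ 2 -
      32 * m * (2 ^ (k + 2) * u) ^ 4 := by exact_mod_cast h
  have hval {z : ℤ} (hz : Odd z) : padicValRat 2 (z : ℚ) = 0 := by
    rw [padicValRat.of_int, padicValInt.eq_zero_of_not_dvd]
    · rfl
    · exact_mod_cast Int.two_dvd_ne_zero.2 (Int.odd_iff.1 hz)
  refine ⟨m / (2 ^ (k + 2) * u) ^ 2, ⟨|n / (2 ^ (k + 2) * u) ^ 3|, by positivity,
    by positivity, ?_⟩, ?_⟩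
  · rw [sq_abs]
    field_simp
    linear_combination hq
  · have h2 : padicValRat 2 (2 : ℚ) = 1 := by exact_mod_cast padicValRat.self one_lt_two
    have : (2 : ℚ) ^ (k + 2) ≠ 0 := by positivity
    rw [padicValRat.div hm0.ne' (by positivity), padicValRat.pow,
      padicValRat.mul this hu0, padicValRat.pow, hval hmo, hval huo, h2]
    push_cast
    ring

lemma exists_isPositivePoint_gt
    (hfin : {x : ℚ | x < 4 ∧ ∃ y, IsPositivePoint x y}.Finite) {M : ℚ} (hM : 4 ≤ M) :
    ∃ x y, M < x ∧ IsPositivePoint x y := by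
  by_contra! hbd
  have hinf := infinite_positivePoints.sdiff hfin
  have hmaps : Set.MapsTo (fun x : ℚ => ⌊x * M⌋)
      ({x : ℚ | ∃ y, IsPositivePoint x y} \ {x : ℚ | x < 4 ∧ ∃ y, IsPositivePoint x y})
      (Set.Icc 0 ⌊M * M⌋) := by
    rintro x ⟨⟨y, hy⟩, -⟩
    have hxM : x ≤ M := le_of_not_gt fun h => hbd x y h hy
    exact ⟨Int.floor_nonneg.2 (mul_nonneg hy.1.le (by linarith)),
      Int.floor_mono (mul_le_mul_of_nonneg_right hxM (by linarith))⟩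
  obtain ⟨x₁, ⟨⟨y₁, hp₁⟩, hx₁⟩, x₂, ⟨⟨y₂, hp₂⟩, hx₂⟩, hne, hfl⟩ :=
    hinf.exists_ne_map_eq_of_mapsTo hmaps (Set.finite_Icc _ _)
  have hx₁ : 4 ≤ x₁ := le_of_not_gt fun h => hx₁ ⟨h, y₁, hp₁⟩
  have hx₂ : 4 ≤ x₂ := le_of_not_gt fun h => hx₂ ⟨h, y₂, hp₂⟩
  have hM₁ : x₁ ≤ M := le_of_not_gt fun h => hbd x₁ y₁ h hp₁
  have hM₂ : x₂ ≤ M := le_of_not_gt fun h => hbd x₂ y₂ h hp₂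
  have hy₁ := hp₁.four_le hx₁
  have hy₂ := hp₂.four_le hx₂
  have hclose : |(x₂ - x₁) * M| < 1 := by
    have := Int.abs_sub_lt_one_of_floor_eq_floor hfl.symm
    rwa [← sub_mul] at this
  obtain ⟨l, hl⟩ : ∃ l, l * (x₂ - x₁) = -y₂ - y₁ :=
    ⟨(-y₂ - y₁) / (x₂ - x₁), div_mul_cancel₀ _ (sub_ne_zero.2 hne.symm)⟩
  have hcurve := chord_identity hne hp₁.2.2 (by rw [neg_sq]; exact hp₂.2.2) hl
  have hl2 : 64 * M ^ 2 ≤ l ^ 2 := by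
    have h1 : ((x₂ - x₁) * M) ^ 2 ≤ 1 := (sq_le_one_iff_abs_le_one _).2 hclose.le
    have h2 : l ^ 2 * (x₂ - x₁) ^ 2 = (y₂ + y₁) ^ 2 := by rw [← mul_pow, hl]; ring
    have h3 : 64 ≤ l ^ 2 * (x₂ - x₁) ^ 2 := by rw [h2]; nlinarith
    calc 64 * M ^ 2 ≤ (l ^ 2 * (x₂ - x₁) ^ 2) * M ^ 2 := by gcongr
      _ = l ^ 2 * ((x₂ - x₁) * M) ^ 2 := by ring
      _ ≤ l ^ 2 * 1 := by gcongr
      _ = l ^ 2 := mul_one _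
  have hgt : M < l ^ 2 - 5 - x₁ - x₂ := by nlinarith
  exact hbd _ _ hgt (isPositivePoint_abs (by linarith) hcurve)

/-- Adding points close to infinity to `(4, 4)` gives points approaching `(4, 4)` from the left. -/
lemma exists_isPositivePoint_near_four
    (hfin : {x : ℚ | x < 4 ∧ ∃ y, IsPositivePoint x y}.Finite) {δ : ℚ} (hδ : 0 < δ)
    (hδ' : δ ≤ 1 / 4) : ∃ x y, 4 - δ < x ∧ x < 4 ∧ IsPositivePoint x y := by
  have hM : 2048 ≤ 2048 / δ ^ 2 := by
    rw [le_div_iff₀ (by positivity)]; nlinarith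
  obtain ⟨x, y, hx, hp⟩ := exists_isPositivePoint_gt hfin (M := 2048 / δ ^ 2) (by linarith)
  obtain ⟨hx0, hy0, hxy⟩ := hp
  have hδx : 2048 < x * δ ^ 2 := (div_lt_iff₀ (by positivity)).1 hx
  have hy7 : 7 * x < y := by
    apply lt_of_pow_lt_pow_left₀ 2 hy0.le
    rw [hxy]
    have : 0 < x ^ 2 - 44 * x - 32 := by nlinarith
    nlinarith [mul_pos hx0 this]
  have hy_small : 32 * y < δ * x ^ 2 := by
    apply lt_of_pow_lt_pow_left₀ 2 (by positivity)
    have h1 : y ^ 2 ≤ 2 * x ^ 3 := by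
      have : 0 < x ^ 2 - 5 * x + 32 := by nlinarith
      nlinarith [mul_pos hx0 this]
    have h2 : 2048 * x ^ 3 < (x * δ ^ 2) * x ^ 3 := by gcongr
    nlinarith
  have hx4 : 0 < x - 4 := by linarith
  obtain ⟨l, hl⟩ : ∃ l, l * (x - 4) = y - 4 := ⟨(y - 4) / (x - 4), div_mul_cancel₀ _ hx4.ne'⟩
  have hcurve := chord_identity (x₁ := 4) (y₁ := 4) (by linarith) (by norm_num) hxy hl
  have hdiff : (4 - (l ^ 2 - 5 - 4 - x)) * (x - 4) ^ 2 = 8 * (y - 7 * x + 24) := by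
    linear_combination -(l * (x - 4) + (y - 4)) * hl - hxy
  have hlt : l ^ 2 - 5 - 4 - x < 4 := by
    have : 0 < (4 - (l ^ 2 - 5 - 4 - x)) * (x - 4) ^ 2 := by rw [hdiff]; linarith
    linarith [pos_of_mul_pos_left this (sq_nonneg _)]
  have hgt : 4 - δ < l ^ 2 - 5 - 4 - x := by
    have h1 : (4 - (l ^ 2 - 5 - 4 - x)) * (x - 4) ^ 2 < δ * (x - 4) ^ 2 := by
      rw [hdiff]
      have : x ^ 2 ≤ 4 * (x - 4) ^ 2 := by nlinarith
      nlinarith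
    linarith [lt_of_mul_lt_mul_right h1 (sq_nonneg _)]
  exact ⟨_, _, hgt, hlt, isPositivePoint_abs (by linarith) hcurve⟩

lemma infinite_positivePoints_lt_four :
    {x : ℚ | x < 4 ∧ ∃ y, IsPositivePoint x y}.Infinite := by
  intro hfin
  obtain ⟨m, hm, hmax⟩ : ∃ m : ℚ, (15 / 4 ≤ m ∧ m < 4) ∧
      ∀ x ∈ {x : ℚ | x < 4 ∧ ∃ y, IsPositivePoint x y}, x ≤ m := by
    obtain ⟨m, hm, hmax⟩ := Set.exists_max_image _ id (hfin.insert (15 / 4)) ⟨_, Set.mem_insert _ _⟩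
    refine ⟨m, ⟨hmax _ (Set.mem_insert _ _), ?_⟩, fun x hx => hmax x (Set.mem_insert_of_mem _ hx)⟩
    rcases hm with rfl | hm
    · norm_num
    · exact hm.1
  obtain ⟨x, y, hx, hx4, hp⟩ :=
    exists_isPositivePoint_near_four hfin (δ := 4 - m) (by linarith) (by linarith)
  linarith [hmax x ⟨hx4, y, hp⟩]

/-- Every triple of rationals with positive first entry is proportional to a primitive triple. -/
lemma exists_primitive_triple {A B C : ℚ} (hA : 0 < A) : ∃ (k : ℚ) (a b c : ℤ), 0 < k ∧
    Int.gcd (Int.gcd a b) c = 1 ∧ (a : ℚ) = k * A ∧ (b : ℚ) = k * B ∧ (c : ℚ) = k * C := by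
  obtain ⟨D, a₀, b₀, c₀, hD, ha₀, hb₀, hc₀⟩ : ∃ (D : ℚ) (a₀ b₀ c₀ : ℤ), 0 < D ∧
      (a₀ : ℚ) = D * A ∧ (b₀ : ℚ) = D * B ∧ (c₀ : ℚ) = D * C := by
    have hd (r : ℚ) : (r.den : ℚ) * r = r.num := Rat.den_mul_eq_num r
    refine ⟨A.den * B.den * C.den, A.num * B.den * C.den, B.num * A.den * C.den,
      C.num * A.den * B.den, ?_, ?_, ?_, ?_⟩
    · have := A.den_pos; have := B.den_pos; have := C.den_pos; positivity
    · push_cast; rw [← hd A]; ring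
    · push_cast; rw [← hd B]; ring
    · push_cast; rw [← hd C]; ring
  have ha₀0 : a₀ ≠ 0 := by
    rintro rfl
    have := mul_pos hD hA
    simp only [Int.cast_zero] at ha₀
    linarith
  have hg : 0 < Int.gcd (Int.gcd a₀ b₀) c₀ :=
    Int.gcd_pos_of_ne_zero_left _ (by exact_mod_cast (Int.gcd_pos_of_ne_zero_left _ ha₀0).ne')
  set g := Int.gcd (Int.gcd a₀ b₀) c₀ with hgdef
  have hgab : (g : ℤ) ∣ (Int.gcd a₀ b₀ : ℤ) := Int.gcd_dvd_left ..
  obtain ⟨a, ha⟩ := hgab.trans (Int.gcd_dvd_left ..)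
  obtain ⟨b, hb⟩ := hgab.trans (Int.gcd_dvd_right ..)
  obtain ⟨c, hc⟩ : (g : ℤ) ∣ c₀ := Int.gcd_dvd_right ..
  have hg' : (0 : ℚ) < g := by exact_mod_cast hg
  refine ⟨D / g, a, b, c, by positivity, ?_, ?_, ?_, ?_⟩
  · rw [ha, hb, hc, Int.gcd_mul_left, Int.natAbs_natCast, Nat.cast_mul, Int.gcd_mul_left,
      Int.natAbs_natCast] at hgdef
    exact Nat.eq_of_mul_eq_mul_left hg (by rw [mul_one]; exact hgdef.symm)
  · rw [ha] at ha₀; push_cast at ha₀; field_simp; linarith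
  · rw [hb] at hb₀; push_cast at hb₀; field_simp; linarith
  · rw [hc] at hc₀; push_cast at hc₀; field_simp; linarith

/-- There are infinitely many pairwise non-similar integer Sharygin triangles: the set of
primitive triples of pairwise distinct positive integers satisfying the triangle
inequalities and `q(a,b,c) = 0` is infinite. -/
theorem infinitely_many_integer_sharygin_triangles :
    {t : ℤ × ℤ × ℤ |
      0 < t.1 ∧ 0 < t.2.1 ∧ 0 < t.2.2 ∧
      Int.gcd (Int.gcd t.1 t.2.1) t.2.2 = 1 ∧
      t.1 ≠ t.2.1 ∧ t.1 ≠ t.2.2 ∧ t.2.1 ≠ t.2.2 ∧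
      t.1 < t.2.1 + t.2.2 ∧ t.2.1 < t.1 + t.2.2 ∧ t.2.2 < t.1 + t.2.1 ∧
      q t.1 t.2.1 t.2.2 = 0}.Infinite := by
  refine Set.Infinite.of_image
    (fun t : ℤ × ℤ × ℤ => ((8 * t.2.2 + 4 * (t.1 + t.2.1)) / (t.2.2 + 2 * (t.1 + t.2.1)) : ℚ))
    (infinite_positivePoints_lt_four.mono ?_)
  rintro x ⟨hx4, y, hp⟩
  have hx3 := hp.three_lt
  obtain ⟨hx0, hy0, hxy⟩ := hp
  have hy : y < 2 * x - 4 := by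
    apply lt_of_pow_lt_pow_left₀ 2 (by linarith)
    nlinarith [mul_pos (mul_pos (sub_pos.2 hx4) (by linarith : 0 < x + 1))
      (by linarith : 0 < x + 4)]
  have hne : y ^ 2 ≠ (5 * x - 16) ^ 2 := by
    intro h
    have : 0 < (4 - x) * (8 - x) ^ 2 := mul_pos (by linarith) (pow_pos (by linarith) 2)
    nlinarith
  obtain ⟨k, a, b, c, hk, hgcd, ha, hb, hc⟩ :=
    exists_primitive_triple (A := 8 - x + y) (B := 8 - x - y) (C := 4 * (x - 2)) (by linarith)
  refine ⟨(a, b, c), ⟨?_, ?_, ?_, hgcd, ?_, ?_, ?_, ?_, ?_, ?_, ?_⟩, ?_⟩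
  · have : (0 : ℚ) < a := by rw [ha]; exact mul_pos hk (by linarith)
    exact_mod_cast this
  · have : (0 : ℚ) < b := by rw [hb]; exact mul_pos hk (by linarith)
    exact_mod_cast this
  · have : (0 : ℚ) < c := by rw [hc]; exact mul_pos hk (by linarith)
    exact_mod_cast this
  · rintro (rfl : a = b)
    have := mul_left_cancel₀ hk.ne' (ha.symm.trans hb)
    linarith
  · rintro (rfl : a = c)
    have := mul_left_cancel₀ hk.ne' (ha.symm.trans hc)
    exact hne (by rw [show y = 5 * x - 16 by linarith])
  · rintro (rfl : b = c)
    have := mul_left_cancel₀ hk.ne' (hb.symm.trans hc)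
    exact hne (by rw [show y = -(5 * x - 16) by linarith, neg_sq])
  · have : (a : ℚ) < b + c := by rw [ha, hb, hc, ← mul_add]; exact mul_lt_mul_of_pos_left (by linarith) hk
    exact_mod_cast this
  · have : (b : ℚ) < a + c := by rw [ha, hb, hc, ← mul_add]; exact mul_lt_mul_of_pos_left (by linarith) hk
    exact_mod_cast this
  · have : (c : ℚ) < a + b := by rw [ha, hb, hc, ← mul_add]; exact mul_lt_mul_of_pos_left (by linarith) hk
    exact_mod_cast this
  · have : (q a b c : ℚ) = 0 := by
      simp only [q]
      push_cast
      rw [ha, hb, hc]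
      linear_combination 24 * k ^ 3 * hxy
    exact_mod_cast this
  · simp only [ha, hb, hc]
    rw [div_eq_iff]
    · ring
    · have : 0 < k * 24 := by positivity
      refine ne_of_gt ?_
      linarith
end
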